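/- For all n ≥ 0 and 0 ≤ k ≤ n, the map r : S_{n+1} → S_{n+1} defined by (r(π))_i = n + 2 - π_{n+2-i} restricts to a bijection from the set B = {π ∈ S_{n+1} : π is 312-avoiding, π_{n+1} = n+1, π has no double descents, and π has exactly n-k ascents} onto the set A = {π ∈ S_{n+1} : π is 231-avoiding, π has exactly k descents, and π has exactly k peaks}. -/

import Mathlib

/-- `w` is (the word of) a permutation of `{1, …, n}`. -/
def IsPermWord (n : ℕ) (w : List ℕ) : Prop := w.Perm (List.range' 1 n)

/-- `w` is 312-avoiding: there are no positions `i < j < k` with `w_j < w_k < w_i`. -/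
def Avoids312 (w : List ℕ) : Prop :=
  ¬ ∃ i j k : ℕ, i < j ∧ j < k ∧ k < w.length ∧
      w.getD j 0 < w.getD k 0 ∧ w.getD k 0 < w.getD i 0

/-- `w` is 231-avoiding: there are no positions `i < j < k` with `w_k < w_i < w_j`. -/
def Avoids231 (w : List ℕ) : Prop :=
  ¬ ∃ i j k : ℕ, i < j ∧ j < k ∧ k < w.length ∧
      w.getD k 0 < w.getD i 0 ∧ w.getD i 0 < w.getD j 0

/-- `w` has a double descent: three consecutive strictly decreasing entries. -/
def HasDoubleDescent (w : List ℕ) : Prop :=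
  ∃ i : ℕ, i + 2 < w.length ∧
    w.getD (i + 1) 0 < w.getD i 0 ∧ w.getD (i + 2) 0 < w.getD (i + 1) 0

/-- The set of (0-indexed) ascents of a word. -/
def ascentSet (w : List ℕ) : Finset ℕ :=
  (Finset.range (w.length - 1)).filter fun i => w.getD i 0 < w.getD (i + 1) 0

/-- The set of (0-indexed) descents of a word. -/
def descentSet (w : List ℕ) : Finset ℕ :=
  (Finset.range (w.length - 1)).filter fun i => w.getD (i + 1) 0 < w.getD i 0

/-- The set of (0-indexed) peaks of a word: positions `1 ≤ i ≤ m - 2` (0-indexed)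
with `w_{i-1} < w_i > w_{i+1}`. -/
def peakSet (w : List ℕ) : Finset ℕ :=
  (Finset.Icc 1 (w.length - 2)).filter fun i =>
    w.getD (i - 1) 0 < w.getD i 0 ∧ w.getD (i + 1) 0 < w.getD i 0

/-- The reverse-complement map `r` on words of permutations in `S_{n+1}`:
`(r(π))_i = n + 2 - π_{n+2-i}` (1-indexed). -/
def rword (n : ℕ) (w : List ℕ) : List ℕ :=
  (List.range (n + 1)).map fun j => n + 2 - w.getD (n - j) 0

theorem isPermWord_iff_getD {m : ℕ} {w : List ℕ} :
    IsPermWord m w ↔ w.length = m ∧ (∀ i < m, 1 ≤ w.getD i 0 ∧ w.getD i 0 ≤ m) ∧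
      ∀ i < m, ∀ j < m, w.getD i 0 = w.getD j 0 → i = j := by
  constructor
  · intro h
    have hl : w.length = m := by simpa using h.length_eq
    have hn : w.Nodup := h.nodup_iff.2 List.nodup_range'
    refine ⟨hl, fun i hi => ?_, fun i hi j hj hij => ?_⟩
    · rw [List.getD_eq_getElem _ _ (hl ▸ hi)]
      have := h.mem_iff.1 (List.getElem_mem (hl ▸ hi : i < w.length))
      rw [List.mem_range'_1] at this
      omega
    · rw [List.getD_eq_getElem _ _ (hl ▸ hi), List.getD_eq_getElem _ _ (hl ▸ hj)] at hij
      exact (hn.getElem_inj_iff).1 hij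
  · rintro ⟨hl, hb, hinj⟩
    have hn : w.Nodup := by
      rw [List.nodup_iff_injective_getElem]
      rintro ⟨i, hi⟩ ⟨j, hj⟩ hij
      have := hinj i (hl ▸ hi) j (hl ▸ hj)
      rw [List.getD_eq_getElem _ _ hi, List.getD_eq_getElem _ _ hj] at this
      exact Fin.ext (this hij)
    have hs : w ⊆ List.range' 1 m := by
      intro x hx
      obtain ⟨i, hi, rfl⟩ := List.mem_iff_getElem.1 hx
      have := hb i (hl ▸ hi)
      rw [List.getD_eq_getElem _ _ hi] at this
      rw [List.mem_range'_1]
      omega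
    exact (hn.subperm hs).perm_of_length_le (by simp [hl])

theorem IsPermWord.exists_getD_eq {m : ℕ} {w : List ℕ} (h : IsPermWord m w) {x : ℕ}
    (h1 : 1 ≤ x) (hx : x ≤ m) : ∃ i < m, w.getD i 0 = x := by
  have hl : w.length = m := by simpa using h.length_eq
  obtain ⟨i, hi, hix⟩ := List.mem_iff_getElem.1
    (h.mem_iff.2 (List.mem_range'_1.2 ⟨h1, by omega⟩) : x ∈ w)
  exact ⟨i, hl ▸ hi, by rw [List.getD_eq_getElem _ _ hi, hix]⟩

@[simp]
theorem length_rword (n : ℕ) (w : List ℕ) : (rword n w).length = n + 1 := by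
  simp [rword]

theorem getD_rword {n i : ℕ} (w : List ℕ) (hi : i ≤ n) :
    (rword n w).getD i 0 = n + 2 - w.getD (n - i) 0 := by
  rw [List.getD_eq_getElem _ _ (by simp; omega)]
  simp [rword]

theorem IsPermWord.rword {n : ℕ} {w : List ℕ} (h : IsPermWord (n + 1) w) :
    IsPermWord (n + 1) (rword n w) := by
  obtain ⟨-, hb, hinj⟩ := isPermWord_iff_getD.1 h
  refine isPermWord_iff_getD.2 ⟨length_rword n w, fun i hi => ?_, fun i hi j hj hij => ?_⟩
  · rw [getD_rword w (by omega)]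
    have := hb (n - i) (by omega)
    omega
  · rw [getD_rword w (by omega), getD_rword w (by omega)] at hij
    have h1 := hb (n - i) (by omega)
    have h2 := hb (n - j) (by omega)
    have := hinj (n - i) (by omega) (n - j) (by omega) (by omega)
    omega

theorem IsPermWord.rword_rword {n : ℕ} {w : List ℕ} (h : IsPermWord (n + 1) w) :
    _root_.rword n (_root_.rword n w) = w := by
  obtain ⟨hl, hb, -⟩ := isPermWord_iff_getD.1 h
  refine List.ext_getElem (by simp [hl]) fun i hi hi' => ?_
  rw [← List.getD_eq_getElem _ 0 hi, ← List.getD_eq_getElem _ 0 hi', getD_rword _ (by omega),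
    getD_rword _ (by omega), show n - (n - i) = i by omega]
  have := hb i (by omega)
  omega

theorem IsPermWord.getD_rword_lt_iff {n i j : ℕ} {w : List ℕ} (h : IsPermWord (n + 1) w)
    (hi : i ≤ n) (hj : j ≤ n) :
    (_root_.rword n w).getD i 0 < (_root_.rword n w).getD j 0 ↔
      w.getD (n - j) 0 < w.getD (n - i) 0 := by
  obtain ⟨-, hb, -⟩ := isPermWord_iff_getD.1 h
  have h1 := hb (n - i) (by omega)
  have h2 := hb (n - j) (by omega)
  rw [getD_rword w hi, getD_rword w hj]
  omega

theorem IsPermWord.avoids231_rword {n : ℕ} {w : List ℕ} (h : IsPermWord (n + 1) w)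
    (ha : Avoids312 w) : Avoids231 (_root_.rword n w) := by
  rintro ⟨i, j, k, hij, hjk, hk, h1, h2⟩
  rw [length_rword] at hk
  rw [h.getD_rword_lt_iff (by omega) (by omega)] at h1 h2
  have hl := (isPermWord_iff_getD.1 h).1
  exact ha ⟨n - k, n - j, n - i, by omega, by omega, by omega, h2, h1⟩

theorem IsPermWord.avoids312_rword {n : ℕ} {w : List ℕ} (h : IsPermWord (n + 1) w)
    (ha : Avoids231 w) : Avoids312 (_root_.rword n w) := by
  rintro ⟨i, j, k, hij, hjk, hk, h1, h2⟩
  rw [length_rword] at hk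
  rw [h.getD_rword_lt_iff (by omega) (by omega)] at h1 h2
  have hl := (isPermWord_iff_getD.1 h).1
  exact ha ⟨n - k, n - j, n - i, by omega, by omega, by omega, h2, h1⟩

theorem IsPermWord.not_hasDoubleDescent_rword {n : ℕ} {w : List ℕ} (h : IsPermWord (n + 1) w)
    (ha : ¬ HasDoubleDescent w) : ¬ HasDoubleDescent (_root_.rword n w) := by
  rintro ⟨i, hi, h1, h2⟩
  rw [length_rword] at hi
  rw [h.getD_rword_lt_iff (by omega) (by omega)] at h1 h2
  have hl := (isPermWord_iff_getD.1 h).1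
  refine ha ⟨n - (i + 2), by omega, ?_, ?_⟩
  · rwa [show n - (i + 2) + 1 = n - (i + 1) by omega]
  · rwa [show n - (i + 2) + 1 = n - (i + 1) by omega, show n - (i + 2) + 2 = n - i by omega]

theorem IsPermWord.card_descentSet_rword {n : ℕ} {w : List ℕ} (h : IsPermWord (n + 1) w) :
    (descentSet (_root_.rword n w)).card = (descentSet w).card := by
  have hl := (isPermWord_iff_getD.1 h).1
  have key : ∀ i < n, ((_root_.rword n w).getD (i + 1) 0 < (_root_.rword n w).getD i 0 ↔
      w.getD (n - 1 - i + 1) 0 < w.getD (n - 1 - i) 0) := by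
    intro i hi
    rw [h.getD_rword_lt_iff (by omega) (by omega), show n - 1 - i + 1 = n - i by omega,
      show n - 1 - i = n - (i + 1) by omega]
  refine Finset.card_nbij' (fun i => n - 1 - i) (fun i => n - 1 - i) ?_ ?_ ?_ ?_
  · intro i hi
    simp only [descentSet, Finset.coe_filter, Finset.mem_range, Set.mem_ofPred_eq, length_rword,
      hl, Nat.add_sub_cancel] at hi ⊢
    exact ⟨by omega, (key i hi.1).1 hi.2⟩
  · intro i hi
    simp only [descentSet, Finset.coe_filter, Finset.mem_range, Set.mem_ofPred_eq, length_rword,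
      hl, Nat.add_sub_cancel] at hi ⊢
    refine ⟨by omega, (key _ (by omega)).2 ?_⟩
    rw [show n - 1 - (n - 1 - i) = i by omega]
    exact hi.2
  all_goals
    intro i hi
    simp only [descentSet, Finset.coe_filter, Finset.mem_range, Set.mem_ofPred_eq, length_rword,
      hl, Nat.add_sub_cancel] at hi
    change n - 1 - (n - 1 - i) = i
    omega

theorem IsPermWord.card_ascentSet_add_card_descentSet {n : ℕ} {w : List ℕ}
    (h : IsPermWord (n + 1) w) : (ascentSet w).card + (descentSet w).card = n := by
  obtain ⟨hl, -, hinj⟩ := isPermWord_iff_getD.1 h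
  have : descentSet w =
      (Finset.range (w.length - 1)).filter fun i => ¬ w.getD i 0 < w.getD (i + 1) 0 := by
    refine Finset.filter_congr fun i hi => ?_
    rw [Finset.mem_range] at hi
    have := hinj i (by omega) (i + 1) (by omega)
    omega
  rw [this, ascentSet, Finset.card_filter_add_card_filter_not, Finset.card_range, hl,
    Nat.add_sub_cancel]

theorem peakSet_subset_descentSet (w : List ℕ) : peakSet w ⊆ descentSet w := by
  intro i hi
  simp only [peakSet, descentSet, Finset.mem_filter, Finset.mem_Icc, Finset.mem_range] at hi ⊢
  exact ⟨by omega, hi.2.2⟩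

/-- A permutation starting with its least entry and without double descents has only descents
that are peaks. -/
theorem IsPermWord.peakSet_eq_descentSet {n : ℕ} {w : List ℕ} (h : IsPermWord (n + 1) w)
    (h0 : w.getD 0 0 = 1) (hd : ¬ HasDoubleDescent w) : peakSet w = descentSet w := by
  obtain ⟨hl, hb, hinj⟩ := isPermWord_iff_getD.1 h
  refine (peakSet_subset_descentSet w).antisymm fun i hi => ?_
  simp only [peakSet, descentSet, Finset.mem_filter, Finset.mem_Icc, Finset.mem_range] at hi ⊢
  obtain ⟨hi, hlt⟩ := hi
  rcases i with _ | i
  · have := hb 1 (by omega)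
    simp only [zero_add] at hlt
    omega
  · refine ⟨by omega, ?_, hlt⟩
    rw [Nat.add_sub_cancel]
    by_contra hc
    have := hinj i (by omega) (i + 1) (by omega)
    exact hd ⟨i, by omega, by omega, hlt⟩

theorem not_hasDoubleDescent_of_peakSet_eq {w : List ℕ} (h : peakSet w = descentSet w) :
    ¬ HasDoubleDescent w := by
  rintro ⟨i, hi, h1, h2⟩
  have : i + 1 ∈ peakSet w := by
    rw [h, descentSet, Finset.mem_filter, Finset.mem_range]
    exact ⟨by omega, h2⟩
  simp only [peakSet, Finset.mem_filter, Nat.add_sub_cancel] at this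
  omega

/-- A 231-avoiding permutation all of whose descents are peaks starts with its least entry. -/
theorem IsPermWord.getD_zero_eq_one {n : ℕ} {w : List ℕ} (h : IsPermWord (n + 1) w)
    (ha : Avoids231 w) (hp : peakSet w = descentSet w) : w.getD 0 0 = 1 := by
  obtain ⟨hl, hb, hinj⟩ := isPermWord_iff_getD.1 h
  obtain ⟨i, hi, hi1⟩ := h.exists_getD_eq (x := 1) le_rfl (by omega)
  have h0 := hb 0 (by omega)
  rcases Nat.eq_zero_or_pos i with rfl | hpos
  · exact hi1
  by_contra hne
  have hasc : w.getD 0 0 < w.getD 1 0 := by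
    by_contra hc
    have := hinj 0 (by omega) 1 (by omega)
    have hmem : 0 ∈ peakSet w := by
      rw [hp, descentSet, Finset.mem_filter, Finset.mem_range]
      exact ⟨by omega, by simp only [zero_add]; omega⟩
    simp [peakSet] at hmem
  have hi' : 1 < i := by
    by_contra hc
    obtain rfl : i = 1 := by omega
    omega
  exact ha ⟨0, 1, i, by omega, hi', by omega, by omega, hasc⟩

/-- **Theorem (Statement 13).** For `0 ≤ k ≤ n`, the map `r` restricts to a bijection
from the 312-avoiding permutations in `S_{n+1}` ending in `n+1` with no double
descents and exactly `n - k` ascents, onto the 231-avoiding permutations in `S_{n+1}`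
with exactly `k` descents and exactly `k` peaks. -/
theorem rword_bijection (n k : ℕ) (hk : k ≤ n) :
    Set.BijOn (rword n)
      {w : List ℕ | IsPermWord (n + 1) w ∧ Avoids312 w ∧ w.getD n 0 = n + 1 ∧
        ¬ HasDoubleDescent w ∧ (ascentSet w).card = n - k}
      {w : List ℕ | IsPermWord (n + 1) w ∧ Avoids231 w ∧
        (descentSet w).card = k ∧ (peakSet w).card = k} := by
  refine Set.InvOn.bijOn (f' := rword n)
    ⟨fun w hw => hw.1.rword_rword, fun w hw => hw.1.rword_rword⟩ ?_ ?_
  · rintro w ⟨h, ha, hlast, hd, hc⟩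
    have hcard : (descentSet (rword n w)).card = k := by
      have := h.card_ascentSet_add_card_descentSet
      rw [h.card_descentSet_rword]
      omega
    have h0 : (rword n w).getD 0 0 = 1 := by
      rw [getD_rword w (Nat.zero_le n), Nat.sub_zero, hlast]
      omega
    refine ⟨h.rword, h.avoids231_rword ha, hcard, ?_⟩
    rw [h.rword.peakSet_eq_descentSet h0 (h.not_hasDoubleDescent_rword hd), hcard]
  · rintro w ⟨h, ha, hc, hp⟩
    have heq : peakSet w = descentSet w :=
      Finset.eq_of_subset_of_card_le (peakSet_subset_descentSet w) (by omega)
    refine ⟨h.rword, h.avoids312_rword ha, ?_,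
      h.not_hasDoubleDescent_rword (not_hasDoubleDescent_of_peakSet_eq heq), ?_⟩
    · rw [getD_rword w le_rfl, Nat.sub_self, h.getD_zero_eq_one ha heq]
      omega
    · have := h.rword.card_ascentSet_add_card_descentSet
      rw [h.card_descentSet_rword] at this
      omega
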